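/- Infinitesimal master relation for the zw-chains (the content of Theorem 8.A): let (z,z') and (w,w') be admissible couples. For N ≥ 1 define the matrix Q_N on Ω_N × Ω_N by: Q_N(ℓ, ℓ+ε_i) := (V_N(ℓ+ε_i)/V_N(ℓ))·(z+N−1−ℓ_i)(z'+N−1−ℓ_i) when ℓ+ε_i ∈ Ω_N; Q_N(ℓ, ℓ−ε_i) := (V_N(ℓ−ε_i)/V_N(ℓ))·(w+ℓ_i)(w'+ℓ_i) when ℓ−ε_i ∈ Ω_N; Q_N(ℓ,ℓ'') := 0 for all other ℓ'' ≠ ℓ; and Q_N(ℓ,ℓ) := −∑_{ℓ''≠ℓ} Q_N(ℓ,ℓ''). Then for every N ≥ 2, every ℓ ∈ Ω_N and every ℓ' ∈ Ω_{N−1}: ∑_{ℓ''∈Ω_N} Q_N(ℓ,ℓ'')·Λ^N_{N−1}(ℓ'',ℓ') = ∑_{ℓ''∈Ω_{N−1}} Λ^N_{N−1}(ℓ,ℓ'')·Q_{N−1}(ℓ'',ℓ'), where all sums have only finitely many nonzero terms. -/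

import Mathlib

open scoped Classical

/-- A couple `(u, u')` of complex numbers is *admissible* if for every integer `l`
the number `(u - l) * (u' - l)` is real and strictly positive. -/
def Admissible (u u' : ℂ) : Prop :=
  ∀ l : ℤ, ((u - l) * (u' - l)).im = 0 ∧ 0 < ((u - l) * (u' - l)).re

/-- The Vandermonde function `V_N(ℓ) = ∏_{1 ≤ i < j ≤ N} (ℓ_i - ℓ_j)`. -/
def Vand (N : ℕ) (ℓ : Fin N → ℤ) : ℤ :=
  ∏ i : Fin N, ∏ j ∈ Finset.Ioi i, (ℓ i - ℓ j)

/-- Membership in `Ω_N = {ℓ ∈ ℤ^N : ℓ_1 > ℓ_2 > ⋯ > ℓ_N}`. -/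
def inOmega {N : ℕ} (ℓ : Fin N → ℤ) : Prop :=
  ∀ i j : Fin N, i < j → ℓ j < ℓ i

/-- `ℓ + ε_i`: add `1` to the `i`-th coordinate. -/
def up {N : ℕ} (ℓ : Fin N → ℤ) (i : Fin N) : Fin N → ℤ :=
  Function.update ℓ i (ℓ i + 1)

/-- `ℓ - ε_i`: subtract `1` from the `i`-th coordinate. -/
def down {N : ℕ} (ℓ : Fin N → ℤ) (i : Fin N) : Fin N → ℤ :=
  Function.update ℓ i (ℓ i - 1)

/-- The off-diagonal part of the matrix `Q_N`: `Q_N(ℓ, ℓ + ε_i)` equals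
`(V_N(ℓ+ε_i)/V_N(ℓ)) (z+N-1-ℓ_i)(z'+N-1-ℓ_i)` when `ℓ + ε_i ∈ Ω_N`, the entry
`Q_N(ℓ, ℓ - ε_i)` equals `(V_N(ℓ-ε_i)/V_N(ℓ)) (w+ℓ_i)(w'+ℓ_i)` when `ℓ - ε_i ∈ Ω_N`,
and all other off-diagonal entries vanish. -/
noncomputable def offQ (z z' w w' : ℂ) (N : ℕ) (ℓ ℓ'' : Fin N → ℤ) : ℂ :=
  ∑ i : Fin N,
    ((if ℓ'' = up ℓ i ∧ inOmega ℓ'' then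
        ((Vand N (up ℓ i) : ℂ) / (Vand N ℓ : ℂ)) *
          ((z + (N : ℂ) - 1 - (ℓ i : ℂ)) * (z' + (N : ℂ) - 1 - (ℓ i : ℂ)))
      else 0)
     + (if ℓ'' = down ℓ i ∧ inOmega ℓ'' then
        ((Vand N (down ℓ i) : ℂ) / (Vand N ℓ : ℂ)) *
          ((w + (ℓ i : ℂ)) * (w' + (ℓ i : ℂ)))
      else 0))

/-- The matrix `Q_N` of jump rates of the `N`-particle `zw`-chain, with the diagonal
entry `Q_N(ℓ,ℓ) = -∑_{ℓ'' ≠ ℓ} Q_N(ℓ,ℓ'')` (the sum has finitely many nonzero terms). -/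
noncomputable def Qmat (z z' w w' : ℂ) (N : ℕ) (ℓ ℓ'' : Fin N → ℤ) : ℂ :=
  if ℓ'' = ℓ then -∑ᶠ (y : Fin N → ℤ) (_ : y ≠ ℓ), offQ z z' w w' N ℓ y
  else offQ z z' w w' N ℓ ℓ''

/-- `Dim_N(ℓ) = V_N(ℓ)/(1! 2! ⋯ (N-1)!)`. -/
def DimQ (N : ℕ) (ℓ : Fin N → ℤ) : ℚ :=
  (Vand N ℓ : ℚ) / ∏ k ∈ Finset.range N, (Nat.factorial k : ℚ)

/-- `ℓ' ≺ ℓ`: the point `ℓ' ∈ Ω_{N-1}` interlaces `ℓ ∈ Ω_N`, i.e.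
`ℓ_{i+1} ≤ ℓ'_i ≤ ℓ_i - 1` for all `i`. -/
def interlace {M : ℕ} (ℓ' : Fin M → ℤ) (ℓ : Fin (M + 1) → ℤ) : Prop :=
  ∀ i : Fin M, ℓ i.succ ≤ ℓ' i ∧ ℓ' i ≤ ℓ i.castSucc - 1

/-- The Gelfand–Tsetlin link `Λ^N_{N-1}(ℓ,ℓ') = Dim_{N-1}(ℓ')/Dim_N(ℓ)` if `ℓ' ≺ ℓ`,
and `0` otherwise (regarded as a complex number). -/
noncomputable def GTlink (M : ℕ) (ℓ : Fin (M + 1) → ℤ) (ℓ' : Fin M → ℤ) : ℂ :=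
  if interlace ℓ' ℓ then ((DimQ M ℓ' / DimQ (M + 1) ℓ : ℚ) : ℂ) else 0

theorem sum_det_updateRow_mul {n : Type*} [Fintype n] [DecidableEq n] {R : Type*} [CommRing R]
    (A T : Matrix n n R) :
    ∑ i, (A.updateRow i ((A * T) i)).det = T.trace * A.det := by
  have h : ∀ i, (A.updateRow i ((A * T) i)).det = (A * T * A.adjugate) i i := by
    intro i
    rw [Matrix.mul_apply, ← Matrix.cramer_transpose_apply, Matrix.cramer_eq_adjugate_mulVec,
      ← Matrix.adjugate_transpose]
    simp [Matrix.mulVec, dotProduct, mul_comm]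
  calc ∑ i, (A.updateRow i ((A * T) i)).det = (A * T * A.adjugate).trace := by
        simp [h, Matrix.trace]
    _ = (T * (A.adjugate * A)).trace := by
        rw [Matrix.mul_assoc, Matrix.trace_mul_comm, Matrix.mul_assoc]
    _ = T.trace * A.det := by
        rw [Matrix.adjugate_mul]; simp [mul_comm]

open Polynomial in
/-- The polynomial whose values are the image of `x ^ k` under the difference operator
`f ↦ (A + x) (B + x) (f (x - 1) - f x) + (w - x) (w' - x) (f (x + 1) - f x)`. -/
noncomputable def differencePoly (A B w w' : ℂ) (k : ℕ) : ℂ[X] :=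
  (C A + X) * (C B + X) * ((X + C (-1)) ^ k - X ^ k) +
    (C w - X) * (C w' - X) * ((X + C 1) ^ k - X ^ k)

theorem eval_differencePoly (A B w w' x : ℂ) (k : ℕ) :
    (differencePoly A B w w' k).eval x =
      (A + x) * (B + x) * ((x - 1) ^ k - x ^ k) +
        (w - x) * (w' - x) * ((x + 1) ^ k - x ^ k) := by
  simp [differencePoly, sub_eq_add_neg]

open Polynomial in
theorem coeff_quadratic_mul (p s : ℂ) (q : ℂ[X]) (m : ℕ) :
    ((X ^ 2 + C s * X + C p) * q).coeff m =
      (if 2 ≤ m then q.coeff (m - 2) else 0) + s * (if 1 ≤ m then q.coeff (m - 1) else 0)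
        + p * q.coeff m := by
  have h : (X ^ 2 + C s * X + C p) * q = q * X ^ 2 + C s * (q * X ^ 1) + C p * q := by ring
  rw [h]
  simp only [coeff_add, coeff_C_mul, coeff_mul_X_pow']

open Polynomial in
theorem coeff_differencePoly (A B w w' : ℂ) (k m : ℕ) (hkm : k ≤ m) :
    (differencePoly A B w w' k).coeff m =
      if m = k then (k : ℂ) * (k - 1) - k * (A + B + w + w') else 0 := by
  have h : differencePoly A B w w' k =
      (X ^ 2 + C (A + B) * X + C (A * B)) * ((X + C (-1)) ^ k - X ^ k) +
      (X ^ 2 + C (-(w + w')) * X + C (w * w')) * ((X + C 1) ^ k - X ^ k) := by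
    simp only [differencePoly, C_add, C_mul, C_neg]; ring
  rw [h, coeff_add, coeff_quadratic_mul, coeff_quadratic_mul]
  simp only [coeff_sub, coeff_X_add_C_pow, coeff_X_pow]
  obtain ⟨d, rfl⟩ := Nat.exists_eq_add_of_le hkm
  match d, k with
  | 0, 0 => simp
  | 0, 1 => simp; ring
  | 0, k + 2 =>
    have h2 : ((k + 2).choose k : ℂ) = (k + 2) * (k + 1) / 2 := by
      rw [Nat.choose_symm_add, Nat.cast_choose_two]; push_cast; ring
    have h3 : k + 2 - k = 2 := by omega
    have h4 : k + 2 - (k + 1) = 1 := by omega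
    simp [h2, h3, h4]; ring
  | 1, 0 => simp
  | 1, k + 1 =>
    have h4 : k + 1 - k = 1 := by omega
    simp [h4]
  | d + 2, k =>
    have h2 : k.choose (k + (d + 1)) = 0 := Nat.choose_eq_zero_of_lt (by omega)
    have h3 : k.choose (k + (d + 2)) = 0 := Nat.choose_eq_zero_of_lt (by omega)
    have h5 : k + (d + 2) - 2 = k + d := by omega
    have h6 : k + (d + 2) - 1 = k + (d + 1) := by omega
    rcases Nat.eq_zero_or_pos d with rfl | hd
    · simp [h3, h5, h6]
    · have h4 : k.choose (k + d) = 0 := Nat.choose_eq_zero_of_lt (by omega)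
      simp [h2, h3, h4, h5, h6]; omega

theorem sum_det_vandermonde_shift (A B w w' : ℂ) (N : ℕ) (v : Fin N → ℂ) :
    ∑ i, ((A + v i) * (B + v i) *
          (Matrix.vandermonde (Function.update v i (v i - 1))).det +
        (w - v i) * (w' - v i) *
          (Matrix.vandermonde (Function.update v i (v i + 1))).det) =
      (∑ k ∈ Finset.range N, ((k : ℂ) * (k - 1) - k * (A + B + w + w')) +
        ∑ i, ((A + v i) * (B + v i) + (w - v i) * (w' - v i))) *
          (Matrix.vandermonde v).det := by
  have hupd : ∀ i x, Matrix.vandermonde (Function.update v i x) =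
      (Matrix.vandermonde v).updateRow i (fun k => x ^ (k : ℕ)) := by
    intro i x
    ext j k
    by_cases h : j = i
    · subst h; simp [Matrix.vandermonde_apply]
    · simp [Matrix.vandermonde_apply, h]
  let T : Matrix (Fin N) (Fin N) ℂ := fun m k => (differencePoly A B w w' k).coeff m
  have hT : T.trace = ∑ k ∈ Finset.range N, ((k : ℂ) * (k - 1) - k * (A + B + w + w')) := by
    rw [Finset.sum_range]
    exact Finset.sum_congr rfl fun k _ => (coeff_differencePoly A B w w' k k le_rfl).trans (if_pos rfl)
  have hrow : ∀ i, (Matrix.vandermonde v * T) i =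
      ((A + v i) * (B + v i)) • (fun k : Fin N => (v i - 1) ^ (k : ℕ)) +
      (((w - v i) * (w' - v i)) • (fun k : Fin N => (v i + 1) ^ (k : ℕ)) +
      (-((A + v i) * (B + v i) + (w - v i) * (w' - v i))) • Matrix.vandermonde v i) := by
    intro i
    ext k
    have hdeg : (differencePoly A B w w' k).natDegree < N := by
      refine lt_of_le_of_lt ?_ k.2
      rw [Polynomial.natDegree_le_iff_coeff_eq_zero]
      intro m hm
      rw [coeff_differencePoly _ _ _ _ _ _ hm.le, if_neg hm.ne']
    have h := Polynomial.eval_eq_sum_range' hdeg (v i)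
    rw [eval_differencePoly, Finset.sum_range] at h
    rw [Matrix.mul_apply]
    simp only [Matrix.vandermonde_apply, T, Pi.add_apply, Pi.smul_apply, smul_eq_mul]
    rw [Finset.sum_congr rfl fun m _ => mul_comm _ _, ← h]
    ring
  have key := sum_det_updateRow_mul (Matrix.vandermonde v) T
  rw [hT] at key
  rw [add_mul, ← key, Finset.sum_mul, ← Finset.sum_add_distrib]
  refine Finset.sum_congr rfl fun i _ => ?_
  rw [hrow, Matrix.det_updateRow_add, Matrix.det_updateRow_add, Matrix.det_updateRow_smul,
    Matrix.det_updateRow_smul, Matrix.det_updateRow_smul, Matrix.updateRow_eq_self,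
    hupd, hupd]
  ring

/-- The factor `(z + N - 1 - x) (z' + N - 1 - x)` of the rate of a jump from `x` to `x + 1`. -/
noncomputable def upRate (z z' : ℂ) (N : ℕ) (x : ℤ) : ℂ :=
  (z + (N : ℂ) - 1 - (x : ℂ)) * (z' + (N : ℂ) - 1 - (x : ℂ))

/-- The factor `(w + x) (w' + x)` of the rate of a jump from `x` to `x - 1`. -/
noncomputable def downRate (w w' : ℂ) (x : ℤ) : ℂ :=
  (w + (x : ℂ)) * (w' + (x : ℂ))

/-- The eigenvalue of the `N`-particle difference operator on the Vandermonde function. -/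
noncomputable def vandEigenvalue (z z' w w' : ℂ) (N : ℕ) : ℂ :=
  ∑ k ∈ Finset.range N,
    ((k : ℂ) * (k - 1) - k * ((z + N - 1) + (z' + N - 1) + w + w'))

/-- The total jump rate out of `ℓ`. -/
noncomputable def exitRate (z z' w w' : ℂ) (N : ℕ) (ℓ : Fin N → ℤ) : ℂ :=
  vandEigenvalue z z' w w' N + ∑ i, (upRate z z' N (ℓ i) + downRate w w' (ℓ i))

/-- The off-diagonal part of `Q_N` before the Doob transform by the Vandermonde function. -/
noncomputable def freeOffQ (z z' w w' : ℂ) (N : ℕ) (ℓ y : Fin N → ℤ) : ℂ :=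
  ∑ i, ((if y = up ℓ i then upRate z z' N (ℓ i) else 0) +
    (if y = down ℓ i then downRate w w' (ℓ i) else 0))

/-- The matrix `Q_N` before the Doob transform by the Vandermonde function. -/
noncomputable def freeQ (z z' w w' : ℂ) (N : ℕ) (ℓ y : Fin N → ℤ) : ℂ :=
  freeOffQ z z' w w' N ℓ y - if y = ℓ then exitRate z z' w w' N ℓ else 0

theorem Vand_eq_det (N : ℕ) (ℓ : Fin N → ℤ) :
    (Vand N ℓ : ℂ) = (Matrix.vandermonde fun i => -(ℓ i : ℂ)).det := by
  rw [Matrix.det_vandermonde, Vand]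
  push_cast
  exact Finset.prod_congr rfl fun i _ => Finset.prod_congr rfl fun j _ => by ring

theorem up_apply {N : ℕ} (ℓ : Fin N → ℤ) (i j : Fin N) :
    up ℓ i j = if j = i then ℓ i + 1 else ℓ j := by
  simp [up, Function.update_apply]

theorem down_apply {N : ℕ} (ℓ : Fin N → ℤ) (i j : Fin N) :
    down ℓ i j = if j = i then ℓ i - 1 else ℓ j := by
  simp [down, Function.update_apply]

theorem eq_up_iff {N : ℕ} (ℓ y : Fin N → ℤ) (i : Fin N) : ℓ = up y i ↔ y = down ℓ i := by
  simp only [funext_iff, up_apply, down_apply]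
  constructor <;> intro h j <;> have := h j <;> have := h i <;> grind

theorem eq_down_iff {N : ℕ} (ℓ y : Fin N → ℤ) (i : Fin N) : ℓ = down y i ↔ y = up ℓ i := by
  rw [eq_up_iff]

theorem ne_up {N : ℕ} (ℓ : Fin N → ℤ) (i : Fin N) : ℓ ≠ up ℓ i := fun h => by
  have := congrFun h i
  simp [up_apply] at this

theorem ne_down {N : ℕ} (ℓ : Fin N → ℤ) (i : Fin N) : ℓ ≠ down ℓ i := fun h => by
  have := congrFun h i
  rw [down_apply, if_pos rfl] at this
  omega

theorem sum_Vand_shift (z z' w w' : ℂ) (N : ℕ) (ℓ : Fin N → ℤ) :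
    ∑ i, (upRate z z' N (ℓ i) * Vand N (up ℓ i) + downRate w w' (ℓ i) * Vand N (down ℓ i)) =
      exitRate z z' w w' N ℓ * Vand N ℓ := by
  have h := sum_det_vandermonde_shift (z + N - 1) (z' + N - 1) w w' N fun i => -(ℓ i : ℂ)
  have hup : ∀ i, (Function.update (fun i => -(ℓ i : ℂ)) i (-(ℓ i : ℂ) - 1)) =
      fun j => -(up ℓ i j : ℂ) := by
    intro i; ext j
    by_cases hj : j = i
    · subst hj; simp [up_apply]; ring
    · simp [up_apply, hj]
  have hdown : ∀ i, (Function.update (fun i => -(ℓ i : ℂ)) i (-(ℓ i : ℂ) + 1)) =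
      fun j => -(down ℓ i j : ℂ) := by
    intro i; ext j
    by_cases hj : j = i
    · subst hj; simp [down_apply]; ring
    · simp [down_apply, hj]
  simp only [hup, hdown, ← Vand_eq_det, ← sub_eq_add_neg, sub_neg_eq_add] at h
  exact h

theorem Vand_ne_zero {N : ℕ} {ℓ : Fin N → ℤ} (hℓ : inOmega ℓ) : (Vand N ℓ : ℂ) ≠ 0 := by
  rw [Int.cast_ne_zero, Vand, Finset.prod_ne_zero_iff]
  intro i _
  rw [Finset.prod_ne_zero_iff]
  intro j hj
  have := hℓ i j (Finset.mem_Ioi.1 hj)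
  omega

theorem Vand_eq_zero {N : ℕ} {ℓ : Fin N → ℤ} {i j : Fin N} (hij : i < j) (h : ℓ i = ℓ j) :
    Vand N ℓ = 0 :=
  Finset.prod_eq_zero (Finset.mem_univ i)
    (Finset.prod_eq_zero (Finset.mem_Ioi.2 hij) (by omega))

theorem Vand_up_eq_zero {N : ℕ} {ℓ : Fin N → ℤ} (hℓ : inOmega ℓ) (i : Fin N)
    (h : ¬ inOmega (up ℓ i)) : Vand N (up ℓ i) = 0 := by
  simp only [inOmega, not_forall, not_lt] at h
  obtain ⟨j, k, hjk, h⟩ := h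
  refine Vand_eq_zero hjk (le_antisymm h ?_)
  have := hℓ j k hjk
  simp only [up_apply]
  grind

theorem Vand_down_eq_zero {N : ℕ} {ℓ : Fin N → ℤ} (hℓ : inOmega ℓ) (i : Fin N)
    (h : ¬ inOmega (down ℓ i)) : Vand N (down ℓ i) = 0 := by
  simp only [inOmega, not_forall, not_lt] at h
  obtain ⟨j, k, hjk, h⟩ := h
  refine Vand_eq_zero hjk (le_antisymm h ?_)
  have := hℓ j k hjk
  simp only [down_apply]
  grind

theorem support_shift_subset {ι X : Type*} [Fintype ι] [DecidableEq X] (p q : ι → X) (x : X)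
    (α β : ι → ℂ) (τ : ℂ) (F : X → ℂ) :
    (Function.support fun y => ((∑ i, ((if y = p i then α i else 0) +
      (if y = q i then β i else 0))) - if y = x then τ else 0) * F y) ⊆
      ↑(insert x (Finset.univ.image p ∪ Finset.univ.image q)) := by
  intro y hy
  by_contra hmem
  simp only [Finset.coe_insert, Finset.coe_union, Finset.coe_image, Finset.coe_univ,
    Set.image_univ, Set.mem_insert_iff, Set.mem_union, Set.mem_range, not_or, not_exists] at hmem
  obtain ⟨h1, h2, h3⟩ := hmem
  exact hy (by simp [h1, fun i => Ne.symm (h2 i), fun i => Ne.symm (h3 i)])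

theorem finsum_shift {ι X : Type*} [Fintype ι] [DecidableEq X] (p q : ι → X) (x : X)
    (α β : ι → ℂ) (τ : ℂ) (F : X → ℂ) :
    ∑ᶠ y, ((∑ i, ((if y = p i then α i else 0) +
      (if y = q i then β i else 0))) - if y = x then τ else 0) * F y =
      ∑ i, (α i * F (p i) + β i * F (q i)) - τ * F x := by
  rw [finsum_eq_sum_of_support_subset _ (support_shift_subset p q x α β τ F)]
  simp only [sub_mul, Finset.sum_sub_distrib, Finset.sum_mul, add_mul, ite_mul, zero_mul]
  rw [Finset.sum_comm]
  congr 1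
  · refine Finset.sum_congr rfl fun i _ => ?_
    rw [Finset.sum_add_distrib, Finset.sum_ite_eq', Finset.sum_ite_eq']
    simp
  · rw [Finset.sum_ite_eq']; simp

theorem offQ_eq (z z' w w' : ℂ) {N : ℕ} {ℓ : Fin N → ℤ} (hℓ : inOmega ℓ) (y : Fin N → ℤ) :
    offQ z z' w w' N ℓ y = freeOffQ z z' w w' N ℓ y * (Vand N y / Vand N ℓ) := by
  rw [offQ, freeOffQ, Finset.sum_mul]
  refine Finset.sum_congr rfl fun i _ => ?_
  have hu : (if y = up ℓ i ∧ inOmega y then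
        ((Vand N (up ℓ i) : ℂ) / (Vand N ℓ : ℂ)) *
          ((z + (N : ℂ) - 1 - (ℓ i : ℂ)) * (z' + (N : ℂ) - 1 - (ℓ i : ℂ))) else 0) =
      (if y = up ℓ i then upRate z z' N (ℓ i) else 0) * (Vand N y / Vand N ℓ) := by
    by_cases h : y = up ℓ i
    · subst h
      by_cases h : inOmega (up ℓ i)
      · simp only [h, and_self, if_true, upRate]; ring
      · simp [h, Vand_up_eq_zero hℓ i h]
    · simp [h]
  have hd : (if y = down ℓ i ∧ inOmega y then
        ((Vand N (down ℓ i) : ℂ) / (Vand N ℓ : ℂ)) *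
          ((w + (ℓ i : ℂ)) * (w' + (ℓ i : ℂ))) else 0) =
      (if y = down ℓ i then downRate w w' (ℓ i) else 0) * (Vand N y / Vand N ℓ) := by
    by_cases h : y = down ℓ i
    · subst h
      by_cases h : inOmega (down ℓ i)
      · simp only [h, and_self, if_true, downRate]; ring
      · simp [h, Vand_down_eq_zero hℓ i h]
    · simp [h]
  rw [hu, hd, add_mul]

theorem freeOffQ_self (z z' w w' : ℂ) {N : ℕ} (ℓ : Fin N → ℤ) :
    freeOffQ z z' w w' N ℓ ℓ = 0 := by
  simp [freeOffQ, ne_up, ne_down]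

theorem finsum_offQ (z z' w w' : ℂ) {N : ℕ} {ℓ : Fin N → ℤ} (hℓ : inOmega ℓ) :
    ∑ᶠ (y : Fin N → ℤ) (_ : y ≠ ℓ), offQ z z' w w' N ℓ y = exitRate z z' w w' N ℓ := by
  have h : ∀ y, ∑ᶠ (_ : y ≠ ℓ), offQ z z' w w' N ℓ y =
      ((∑ i, ((if y = up ℓ i then upRate z z' N (ℓ i) else 0) +
      (if y = down ℓ i then downRate w w' (ℓ i) else 0))) - if y = ℓ then 0 else 0) *
      (Vand N y / Vand N ℓ) := by
    intro y
    rw [ite_self, sub_zero]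
    change _ = freeOffQ z z' w w' N ℓ y * _
    rw [← offQ_eq z z' w w' hℓ]
    by_cases hy : y = ℓ
    · subst hy; simp [offQ_eq z z' w w' hℓ, freeOffQ_self]
    · simp [hy]
  rw [finsum_congr h, finsum_shift]
  have := sum_Vand_shift z z' w w' N ℓ
  rw [← div_eq_iff (Vand_ne_zero hℓ)] at this
  rw [← this, Finset.sum_div, zero_mul, sub_zero]
  exact Finset.sum_congr rfl fun i _ => by ring

theorem Qmat_eq (z z' w w' : ℂ) {N : ℕ} {ℓ : Fin N → ℤ} (hℓ : inOmega ℓ) (y : Fin N → ℤ) :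
    Qmat z z' w w' N ℓ y = freeQ z z' w w' N ℓ y * (Vand N y / Vand N ℓ) := by
  rw [Qmat, freeQ]
  split_ifs with h
  · subst h
    rw [finsum_offQ z z' w w' hℓ, freeOffQ_self, div_self (Vand_ne_zero hℓ)]
    ring
  · rw [offQ_eq z z' w w' hℓ, sub_zero]

theorem freeQ_transpose (z z' w w' : ℂ) {N : ℕ} (ℓ y : Fin N → ℤ) :
    freeQ z z' w w' N y ℓ =
      (∑ i, ((if y = down ℓ i then upRate z z' N (ℓ i - 1) else 0) +
        (if y = up ℓ i then downRate w w' (ℓ i + 1) else 0))) -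
        if y = ℓ then exitRate z z' w w' N ℓ else 0 := by
  rw [freeQ, freeOffQ]
  congr 1
  · refine Finset.sum_congr rfl fun i _ => ?_
    rw [if_congr (eq_up_iff ℓ y i) rfl rfl, if_congr (eq_down_iff ℓ y i) rfl rfl]
    congr 1
    · split_ifs with h
      · subst h; simp [down_apply]
      · rfl
    · split_ifs with h
      · subst h; simp [up_apply]
      · rfl
  · by_cases h : y = ℓ
    · subst h; rfl
    · simp [h, Ne.symm h]

theorem interlace.inOmega_right {M : ℕ} {ℓ' : Fin M → ℤ} {ℓ : Fin (M + 1) → ℤ}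
    (h : interlace ℓ' ℓ) : inOmega ℓ := by
  have : StrictAnti ℓ := by
    rw [Fin.strictAnti_iff_succ_lt]
    intro i
    have := h i
    omega
  exact fun i j hij => this hij

theorem interlace.inOmega_left {M : ℕ} {ℓ' : Fin M → ℤ} {ℓ : Fin (M + 1) → ℤ}
    (hℓ : inOmega ℓ) (h : interlace ℓ' ℓ) : inOmega ℓ' := by
  intro i j hij
  have h1 := h i
  have h2 := h j
  have h3 : ℓ j.castSucc ≤ ℓ i.succ := by
    rcases (Fin.succ_le_castSucc_iff.2 hij).eq_or_lt with h | h
    · rw [h]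
    · exact (hℓ _ _ h).le
  omega

theorem interlace_up_succ_iff {M : ℕ} {ℓ' : Fin M → ℤ} {ℓ : Fin (M + 1) → ℤ}
    (h : interlace ℓ' ℓ) (j : Fin M) : interlace ℓ' (up ℓ j.succ) ↔ ℓ j.succ ≠ ℓ' j := by
  constructor
  · intro h1 h2
    have := (h1 j).1
    rw [up_apply, if_pos rfl] at this
    omega
  · intro h1 k
    have := h k
    have := h j
    simp only [up_apply, Fin.succ_inj]
    grind

theorem interlace_up_zero {M : ℕ} {ℓ' : Fin M → ℤ} {ℓ : Fin (M + 1) → ℤ}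
    (h : interlace ℓ' ℓ) : interlace ℓ' (up ℓ 0) := by
  intro k
  have := h k
  simp only [up_apply, Fin.succ_ne_zero, if_false]
  grind

theorem down_interlace_iff {M : ℕ} {ℓ' : Fin M → ℤ} {ℓ : Fin (M + 1) → ℤ}
    (h : interlace ℓ' ℓ) (j : Fin M) : interlace (down ℓ' j) ℓ ↔ ℓ j.succ ≠ ℓ' j := by
  constructor
  · intro h1 h2
    have := (h1 j).1
    rw [down_apply, if_pos rfl] at this
    omega
  · intro h1 k
    have := h k
    simp only [down_apply]
    grind

theorem interlace_down_castSucc_iff {M : ℕ} {ℓ' : Fin M → ℤ} {ℓ : Fin (M + 1) → ℤ}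
    (h : interlace ℓ' ℓ) (j : Fin M) :
    interlace ℓ' (down ℓ j.castSucc) ↔ ℓ j.castSucc ≠ ℓ' j + 1 := by
  constructor
  · intro h1 h2
    have := (h1 j).2
    rw [down_apply, if_pos rfl] at this
    omega
  · intro h1 k
    have := h k
    have := h j
    simp only [down_apply, Fin.castSucc_inj]
    grind

theorem interlace_down_last {M : ℕ} {ℓ' : Fin M → ℤ} {ℓ : Fin (M + 1) → ℤ}
    (h : interlace ℓ' ℓ) : interlace ℓ' (down ℓ (Fin.last M)) := by
  intro k
  have := h k
  simp only [down_apply, Fin.castSucc_ne_last, if_false]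
  grind

theorem up_interlace_iff {M : ℕ} {ℓ' : Fin M → ℤ} {ℓ : Fin (M + 1) → ℤ}
    (h : interlace ℓ' ℓ) (j : Fin M) :
    interlace (up ℓ' j) ℓ ↔ ℓ j.castSucc ≠ ℓ' j + 1 := by
  constructor
  · intro h1 h2
    have := (h1 j).2
    rw [up_apply, if_pos rfl] at this
    omega
  · intro h1 k
    have := h k
    simp only [up_apply]
    grind

theorem not_interlace_up_last {M : ℕ} {ℓ' : Fin M → ℤ} {ℓ : Fin (M + 1) → ℤ}
    (h : ¬ interlace ℓ' ℓ) : ¬ interlace ℓ' (up ℓ (Fin.last M)) := by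
  refine fun h1 => h fun k => ?_
  have := h1 k
  simp only [up_apply, Fin.castSucc_ne_last, if_false] at this
  grind

theorem not_interlace_down_zero {M : ℕ} {ℓ' : Fin M → ℤ} {ℓ : Fin (M + 1) → ℤ}
    (h : ¬ interlace ℓ' ℓ) : ¬ interlace ℓ' (down ℓ 0) := by
  refine fun h1 => h fun k => ?_
  have := h1 k
  simp only [down_apply, Fin.succ_ne_zero, if_false] at this
  grind

/-- The configurations `ℓ'` whose only violation of `ℓ' ≺ ℓ` is `ℓ' j = ℓ j.castSucc`. -/
theorem interlace_up_castSucc_iff {M : ℕ} {ℓ' : Fin M → ℤ} {ℓ : Fin (M + 1) → ℤ}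
    (hℓ : inOmega ℓ) (hℓ' : inOmega ℓ') (h : ¬ interlace ℓ' ℓ) (j : Fin M) :
    interlace ℓ' (up ℓ j.castSucc) ↔ ℓ' j = ℓ j.castSucc ∧
      ∀ k ≠ j, ℓ k.succ ≤ ℓ' k ∧ ℓ' k ≤ ℓ k.castSucc - 1 := by
  constructor
  · intro h1
    have h2 : ∀ k ≠ j, ℓ k.succ ≤ ℓ' k ∧ ℓ' k ≤ ℓ k.castSucc - 1 := by
      intro k hk
      have := h1 k
      simp only [up_apply, Fin.castSucc_inj, hk, if_false] at this
      grind
    refine ⟨?_, h2⟩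
    by_contra h3
    refine h fun k => ?_
    by_cases hk : k = j
    · subst hk
      have := h1 k
      simp only [up_apply, if_true] at this
      grind
    · exact h2 k hk
  · rintro ⟨h1, h2⟩ k
    have h0 := hℓ _ _ (Fin.castSucc_lt_succ (i := j))
    simp only [up_apply, Fin.castSucc_inj]
    by_cases hk : k = j
    · subst hk
      rw [if_neg Fin.castSucc_lt_succ.ne', if_pos rfl]
      omega
    · have h3 := h2 k hk
      rw [if_neg hk]
      split_ifs with hkj
      · have hlt : k < j := by rw [← Fin.succ_le_castSucc_iff, hkj]
        have := hℓ' k j hlt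
        omega
      · exact h3

theorem down_interlace_iff_of_not {M : ℕ} {ℓ' : Fin M → ℤ} {ℓ : Fin (M + 1) → ℤ}
    (hℓ : inOmega ℓ) (h : ¬ interlace ℓ' ℓ) (j : Fin M) :
    interlace (down ℓ' j) ℓ ↔ ℓ' j = ℓ j.castSucc ∧
      ∀ k ≠ j, ℓ k.succ ≤ ℓ' k ∧ ℓ' k ≤ ℓ k.castSucc - 1 := by
  have h0 := hℓ _ _ (Fin.castSucc_lt_succ (i := j))
  constructor
  · intro h1
    have h2 : ∀ k ≠ j, ℓ k.succ ≤ ℓ' k ∧ ℓ' k ≤ ℓ k.castSucc - 1 := by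
      intro k hk
      have := h1 k
      rwa [down_apply, if_neg hk] at this
    refine ⟨?_, h2⟩
    by_contra h3
    refine h fun k => ?_
    by_cases hk : k = j
    · subst hk
      have := h1 k
      rw [down_apply, if_pos rfl] at this
      omega
    · exact h2 k hk
  · rintro ⟨h1, h2⟩ k
    rw [down_apply]
    split_ifs with hk
    · subst hk; omega
    · exact h2 k hk

/-- The configurations `ℓ'` whose only violation of `ℓ' ≺ ℓ` is `ℓ' j + 1 = ℓ j.succ`. -/
theorem interlace_down_succ_iff {M : ℕ} {ℓ' : Fin M → ℤ} {ℓ : Fin (M + 1) → ℤ}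
    (hℓ : inOmega ℓ) (hℓ' : inOmega ℓ') (h : ¬ interlace ℓ' ℓ) (j : Fin M) :
    interlace ℓ' (down ℓ j.succ) ↔ ℓ' j + 1 = ℓ j.succ ∧
      ∀ k ≠ j, ℓ k.succ ≤ ℓ' k ∧ ℓ' k ≤ ℓ k.castSucc - 1 := by
  constructor
  · intro h1
    have h2 : ∀ k ≠ j, ℓ k.succ ≤ ℓ' k ∧ ℓ' k ≤ ℓ k.castSucc - 1 := by
      intro k hk
      have := h1 k
      simp only [down_apply, Fin.succ_inj, hk, if_false] at this
      grind
    refine ⟨?_, h2⟩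
    by_contra h3
    refine h fun k => ?_
    by_cases hk : k = j
    · subst hk
      have := h1 k
      simp only [down_apply, if_true] at this
      grind
    · exact h2 k hk
  · rintro ⟨h1, h2⟩ k
    have h0 := hℓ _ _ (Fin.castSucc_lt_succ (i := j))
    simp only [down_apply, Fin.succ_inj]
    by_cases hk : k = j
    · subst hk
      rw [if_neg Fin.castSucc_lt_succ.ne, if_pos rfl]
      omega
    · have h3 := h2 k hk
      rw [if_neg hk]
      split_ifs with hkj
      · have hlt : j < k := by rw [← Fin.succ_le_castSucc_iff, hkj]
        have := hℓ' j k hlt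
        omega
      · exact h3

theorem up_interlace_iff_of_not {M : ℕ} {ℓ' : Fin M → ℤ} {ℓ : Fin (M + 1) → ℤ}
    (hℓ : inOmega ℓ) (h : ¬ interlace ℓ' ℓ) (j : Fin M) :
    interlace (up ℓ' j) ℓ ↔ ℓ' j + 1 = ℓ j.succ ∧
      ∀ k ≠ j, ℓ k.succ ≤ ℓ' k ∧ ℓ' k ≤ ℓ k.castSucc - 1 := by
  have h0 := hℓ _ _ (Fin.castSucc_lt_succ (i := j))
  constructor
  · intro h1
    have h2 : ∀ k ≠ j, ℓ k.succ ≤ ℓ' k ∧ ℓ' k ≤ ℓ k.castSucc - 1 := by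
      intro k hk
      have := h1 k
      rwa [up_apply, if_neg hk] at this
    refine ⟨?_, h2⟩
    by_contra h3
    refine h fun k => ?_
    by_cases hk : k = j
    · subst hk
      have := h1 k
      rw [up_apply, if_pos rfl] at this
      omega
    · exact h2 k hk
  · rintro ⟨h1, h2⟩ k
    rw [up_apply]
    split_ifs with hk
    · subst hk; omega
    · exact h2 k hk

theorem upRate_sub_one (z z' : ℂ) (N : ℕ) (x : ℤ) :
    upRate z z' N (x - 1) = upRate z z' (N + 1) x := by
  simp only [upRate]; push_cast; ring

theorem vandEigenvalue_succ (z z' w w' : ℂ) (N : ℕ) :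
    vandEigenvalue z z' w w' (N + 1) =
      vandEigenvalue z z' w w' N - N * (z + z' + w + w' + 2 * N) := by
  have hg : ∑ k ∈ Finset.range N, (k : ℂ) * 2 = N * (N - 1) := by
    induction N with
    | zero => simp
    | succ n ih => rw [Finset.sum_range_succ, ih]; push_cast; ring
  rw [vandEigenvalue, vandEigenvalue, Finset.sum_range_succ]
  have h : ∑ k ∈ Finset.range N,
      ((k : ℂ) * (k - 1) - k * ((z + (N + 1 : ℕ) - 1) + (z' + (N + 1 : ℕ) - 1) + w + w')) =
      ∑ k ∈ Finset.range N,
      ((k : ℂ) * (k - 1) - k * ((z + N - 1) + (z' + N - 1) + w + w')) -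
      ∑ k ∈ Finset.range N, (k : ℂ) * 2 := by
    rw [← Finset.sum_sub_distrib]
    exact Finset.sum_congr rfl fun k _ => by push_cast; ring
  rw [h, hg]
  push_cast
  ring

theorem finsum_freeQ_interlace (z z' w w' : ℂ) {M : ℕ} {ℓ : Fin (M + 1) → ℤ} (hℓ : inOmega ℓ)
    {ℓ' : Fin M → ℤ} (hℓ' : inOmega ℓ') :
    ∑ᶠ y, freeQ z z' w w' (M + 1) ℓ y * (if interlace ℓ' y then 1 else 0) =
      ∑ᶠ y, freeQ z z' w w' M y ℓ' * (if interlace y ℓ then 1 else 0) := by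
  simp only [freeQ_transpose z z' w w' ℓ']
  rw [finsum_shift (down ℓ')]
  simp only [freeQ, freeOffQ]
  rw [finsum_shift]
  simp only [upRate_sub_one]
  by_cases h : interlace ℓ' ℓ
  · simp only [exitRate, vandEigenvalue_succ, Finset.sum_add_distrib]
    rw [Fin.sum_univ_succ, Fin.sum_univ_castSucc (n := M)
        (f := fun i => downRate w w' (ℓ i) * _),
      Fin.sum_univ_succ (f := fun i => upRate z z' (M + 1) (ℓ i)),
      Fin.sum_univ_castSucc (f := fun i => downRate w w' (ℓ i)),
      if_pos (interlace_up_zero h), if_pos (interlace_down_last h), if_pos h]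
    have h1 : ∑ j : Fin M, (upRate z z' (M + 1) (ℓ j.succ) *
          (if interlace ℓ' (up ℓ j.succ) then 1 else 0) - upRate z z' (M + 1) (ℓ j.succ)) =
        ∑ j : Fin M, (upRate z z' (M + 1) (ℓ' j) *
          (if interlace (down ℓ' j) ℓ then 1 else 0) - upRate z z' (M + 1) (ℓ' j)) := by
      refine Finset.sum_congr rfl fun j _ => ?_
      simp only [interlace_up_succ_iff h, down_interlace_iff h]
      by_cases hj : ℓ j.succ = ℓ' j <;> simp [hj]
    have h2 : ∑ j : Fin M, (downRate w w' (ℓ j.castSucc) *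
          (if interlace ℓ' (down ℓ j.castSucc) then 1 else 0) - downRate w w' (ℓ j.castSucc)) =
        ∑ j : Fin M, (downRate w w' (ℓ' j + 1) *
          (if interlace (up ℓ' j) ℓ then 1 else 0) - downRate w w' (ℓ' j + 1)) := by
      refine Finset.sum_congr rfl fun j _ => ?_
      simp only [interlace_down_castSucc_iff h, up_interlace_iff h]
      by_cases hj : ℓ j.castSucc = ℓ' j + 1 <;> simp [hj]
    have h3 : ∑ j : Fin M, (upRate z z' (M + 1) (ℓ' j) - upRate z z' M (ℓ' j) +
        (downRate w w' (ℓ' j + 1) - downRate w w' (ℓ' j))) =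
        M * (z + z' + w + w' + 2 * M) := by
      rw [Finset.sum_congr rfl fun j _ => show _ = z + z' + w + w' + 2 * (M : ℂ) by
        simp only [upRate, downRate]; push_cast; ring]
      rw [Finset.sum_const, Finset.card_univ, Fintype.card_fin, nsmul_eq_mul]
    simp only [Finset.sum_sub_distrib, Finset.sum_add_distrib] at h1 h2 h3
    linear_combination h1 + h2 - h3
  · simp only [if_neg h, mul_zero, sub_zero, Finset.sum_add_distrib]
    rw [Fin.sum_univ_castSucc, Fin.sum_univ_succ (n := M)
        (f := fun i => downRate w w' (ℓ i) * _),
      if_neg (not_interlace_up_last h), if_neg (not_interlace_down_zero h), mul_zero, mul_zero,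
      add_zero, zero_add]
    congr 1
    · refine Finset.sum_congr rfl fun j _ => ?_
      simp only [interlace_up_castSucc_iff hℓ hℓ' h, down_interlace_iff_of_not hℓ h]
      by_cases hj : ℓ' j = ℓ j.castSucc <;> simp [hj]
    · refine Finset.sum_congr rfl fun j _ => ?_
      simp only [interlace_down_succ_iff hℓ hℓ' h, up_interlace_iff_of_not hℓ h]
      by_cases hj : ℓ' j + 1 = ℓ j.succ <;> simp [hj]

theorem GTlink_eq (M : ℕ) (ℓ : Fin (M + 1) → ℤ) (ℓ' : Fin M → ℤ) :
    GTlink M ℓ ℓ' =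
      (if interlace ℓ' ℓ then 1 else 0) * (M.factorial * (Vand M ℓ' / Vand (M + 1) ℓ)) := by
  rw [GTlink]
  split_ifs
  · have h : ((∏ k ∈ Finset.range M, (Nat.factorial k : ℚ) : ℚ) : ℂ) ≠ 0 := by
      rw [Rat.cast_ne_zero, Finset.prod_ne_zero_iff]
      exact fun k _ => Nat.cast_ne_zero.2 k.factorial_ne_zero
    rw [DimQ, DimQ, Finset.prod_range_succ, one_mul]
    rw [Rat.cast_div, Rat.cast_div, Rat.cast_div, Rat.cast_mul]
    push_cast at h ⊢
    field_simp
  · simp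

/-- Infinitesimal master relation for the `zw`-chains (Theorem 8.A), stated for
`N = M + 1 ≥ 2`: for `ℓ ∈ Ω_N` and `ℓ' ∈ Ω_{N-1}`,
`∑_{ℓ''} Q_N(ℓ,ℓ'') Λ^N_{N-1}(ℓ'',ℓ') = ∑_{ℓ''} Λ^N_{N-1}(ℓ,ℓ'') Q_{N-1}(ℓ'',ℓ')`,
and both sums have finitely many nonzero terms. -/
theorem zw_master_relation (z z' w w' : ℂ)
    (hz : Admissible z z') (hw : Admissible w w')
    (M : ℕ) (hM : 1 ≤ M)
    (ℓ : Fin (M + 1) → ℤ) (hℓ : inOmega ℓ) (ℓ' : Fin M → ℤ) (hℓ' : inOmega ℓ') :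
    (Function.support
        (fun y : Fin (M + 1) → ℤ => Qmat z z' w w' (M + 1) ℓ y * GTlink M y ℓ')).Finite ∧
    (Function.support
        (fun y : Fin M → ℤ => GTlink M ℓ y * Qmat z z' w w' M y ℓ')).Finite ∧
    ∑ᶠ y : Fin (M + 1) → ℤ, Qmat z z' w w' (M + 1) ℓ y * GTlink M y ℓ'
      = ∑ᶠ y : Fin M → ℤ, GTlink M ℓ y * Qmat z z' w w' M y ℓ' := by
  have hL : ∀ y, Qmat z z' w w' (M + 1) ℓ y * GTlink M y ℓ' =
      (freeQ z z' w w' (M + 1) ℓ y * (if interlace ℓ' y then 1 else 0)) *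
        (M.factorial * (Vand M ℓ' / Vand (M + 1) ℓ)) := by
    intro y
    rw [Qmat_eq z z' w w' hℓ, GTlink_eq]
    split_ifs with h
    · have := Vand_ne_zero h.inOmega_right
      field_simp
    · simp
  have hR : ∀ y, GTlink M ℓ y * Qmat z z' w w' M y ℓ' =
      (freeQ z z' w w' M y ℓ' * (if interlace y ℓ then 1 else 0)) *
        (M.factorial * (Vand M ℓ' / Vand (M + 1) ℓ)) := by
    intro y
    rw [GTlink_eq]
    split_ifs with h
    · have := Vand_ne_zero (h.inOmega_left hℓ)
      rw [Qmat_eq z z' w w' (h.inOmega_left hℓ)]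
      field_simp
    · simp
  simp only [hL, hR]
  refine ⟨?_, ?_, ?_⟩
  · exact (Finset.finite_toSet _).subset ((Function.support_mul_subset_left _ _).trans
      (support_shift_subset (up ℓ) (down ℓ) ℓ (fun i => upRate z z' (M + 1) (ℓ i))
        (fun i => downRate w w' (ℓ i)) (exitRate z z' w w' (M + 1) ℓ) _))
  · simp only [freeQ_transpose z z' w w' ℓ']
    exact (Finset.finite_toSet _).subset ((Function.support_mul_subset_left _ _).trans
      (support_shift_subset (down ℓ') (up ℓ') ℓ' _ _ _ _))
  · rw [← finsum_mul, ← finsum_mul, finsum_freeQ_interlace z z' w w' hℓ hℓ']
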